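/- For every ε > 0, the system S(G, M) admits a (ρ̂(G, M) + ε)-multinorm. -/

import Mathlib

open Filter Matrix

/-- The operator norm on `n × n` real matrices induced by the Euclidean norm on `ℝ^n`. -/
noncomputable def euclOpNorm {n : ℕ} (A : Matrix (Fin n) (Fin n) ℝ) : ℝ :=
  ‖LinearMap.toContinuousLinearMap (Matrix.toEuclideanLin A)‖

/-- The Euclidean norm on `ℝ^n`. -/
noncomputable def euclNorm {n : ℕ} (x : Fin n → ℝ) : ℝ :=
  Real.sqrt (∑ i, x i ^ 2)

/-- The matrix product `A_{σ(t-1)} ⋯ A_{σ(0)}` associated to a sequence of labels `σ`. -/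
noncomputable def pathProd {n N : ℕ} (A : Fin N → Matrix (Fin n) (Fin n) ℝ)
    (t : ℕ) (σ : Fin t → Fin N) : Matrix (Fin n) (Fin n) ℝ :=
  (List.ofFn fun i => A (σ i)).reverse.prod

/-- `v, σ` describe a path of length `t` in the labeled graph with edge set `E`:
its `i`-th edge goes from node `v i` to node `v (i+1)` and carries the label `σ i`. -/
def IsPath {V : Type*} {N : ℕ} (E : Set (V × V × Fin N)) {t : ℕ}
    (v : Fin (t + 1) → V) (σ : Fin t → Fin N) : Prop :=
  ∀ i : Fin t, (v i.castSucc, v i.succ, σ i) ∈ E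

/-- The labeled graph with edge set `E` is strongly connected: any node can be joined to
any node by a path of length at least 1. -/
def StronglyConnected {V : Type*} {N : ℕ} (E : Set (V × V × Fin N)) : Prop :=
  ∀ u w : V, ∃ (t : ℕ) (v : Fin (t + 1) → V) (σ : Fin t → Fin N),
    1 ≤ t ∧ IsPath E v σ ∧ v 0 = u ∧ v (Fin.last t) = w

/-- The constrained joint spectral radius of the system `S(G, M)` with `G = (V, E)`, `M = A`. -/
noncomputable def cjsr {V : Type*} {n N : ℕ} (E : Set (V × V × Fin N))
    (A : Fin N → Matrix (Fin n) (Fin n) ℝ) : ℝ :=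
  Filter.atTop.limsup fun t : ℕ =>
    sSup { x : ℝ | ∃ (v : Fin (t + 1) → V) (σ : Fin t → Fin N),
      IsPath E v σ ∧ x = euclOpNorm (pathProd A t σ) ^ (1 / (t : ℝ)) }

/-- The constrained joint spectral radius of the `T`-lifted system `S(G_T, M^T)`:
paths of length `k` in `G_T` are exactly paths of length `k * T` in `G`. -/
noncomputable def cjsrLift {V : Type*} {n N : ℕ} (E : Set (V × V × Fin N))
    (A : Fin N → Matrix (Fin n) (Fin n) ℝ) (T : ℕ) : ℝ :=
  Filter.atTop.limsup fun k : ℕ =>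
    sSup { x : ℝ | ∃ (v : Fin (k * T + 1) → V) (σ : Fin (k * T) → Fin N),
      IsPath E v σ ∧ x = euclOpNorm (pathProd A (k * T) σ) ^ (1 / (k : ℝ)) }

/-- Stability of the constrained switching system: along every infinite path of the graph,
every trajectory converges to `0`. -/
def Stable {V : Type*} {n N : ℕ} (E : Set (V × V × Fin N))
    (A : Fin N → Matrix (Fin n) (Fin n) ℝ) : Prop :=
  ∀ (v : ℕ → V) (σ : ℕ → Fin N), (∀ t : ℕ, (v t, v (t + 1), σ t) ∈ E) →
    ∀ x0 : Fin n → ℝ,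
      Tendsto (fun t : ℕ => (pathProd A t fun i : Fin t => σ i).mulVec x0)
        atTop (nhds 0)

/-- `ν` is a family of norms on `ℝ^n` indexed by the nodes. -/
def IsNormFamily {V : Type*} {n : ℕ} (ν : V → (Fin n → ℝ) → ℝ) : Prop :=
  ∀ u : V,
    (∀ x y : Fin n → ℝ, ν u (x + y) ≤ ν u x + ν u y) ∧
    (∀ (a : ℝ) (x : Fin n → ℝ), ν u (a • x) = |a| * ν u x) ∧
    (∀ x : Fin n → ℝ, ν u x = 0 → x = 0)

/-- `ν` is a `γ`-multinorm for the system `S(G, M)`. -/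
def IsMultinorm {V : Type*} {n N : ℕ} (E : Set (V × V × Fin N))
    (A : Fin N → Matrix (Fin n) (Fin n) ℝ) (γ : ℝ)
    (ν : V → (Fin n → ℝ) → ℝ) : Prop :=
  IsNormFamily ν ∧
    ∀ vi vj : V, ∀ σ : Fin N, (vi, vj, σ) ∈ E →
      ∀ x : Fin n → ℝ, ν vj ((A σ).mulVec x) ≤ γ * ν vi x

/-- `Q` is a quadratic `γ`-multinorm for the system `S(G, M)`. -/
def IsQuadMultinorm {V : Type*} {n N : ℕ} (E : Set (V × V × Fin N))
    (A : Fin N → Matrix (Fin n) (Fin n) ℝ) (γ : ℝ)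
    (Q : V → Matrix (Fin n) (Fin n) ℝ) : Prop :=
  (∀ u : V, (Q u).PosDef) ∧
    ∀ vi vj : V, ∀ σ : Fin N, (vi, vj, σ) ∈ E →
      (γ ^ 2 • Q vi - (A σ)ᵀ * Q vj * A σ).PosSemidef

/-- `Q` is a quadratic `γ`-multinorm for the lifted system `S(G_T, M^T)`: the Loewner
inequality holds along every path of length `T` of `G` (i.e. every edge of `G_T`). -/
def IsQuadMultinormLift {V : Type*} {n N : ℕ} (E : Set (V × V × Fin N))
    (A : Fin N → Matrix (Fin n) (Fin n) ℝ) (T : ℕ) (γ : ℝ)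
    (Q : V → Matrix (Fin n) (Fin n) ℝ) : Prop :=
  (∀ u : V, (Q u).PosDef) ∧
    ∀ (v : Fin (T + 1) → V) (σ : Fin T → Fin N), IsPath E v σ →
      (γ ^ 2 • Q (v 0) -
        (pathProd A T σ)ᵀ * Q (v (Fin.last T)) * pathProd A T σ).PosSemidef

/-- `Q` is a path-dependent Lyapunov function with memory `T` for `S(G, M)`:
one positive definite quadratic form per path of length `T`, with a strict decrease
condition along every path of length `T + 1`. -/
def IsPathDepLyap {V : Type*} {n N : ℕ} (E : Set (V × V × Fin N))
    (A : Fin N → Matrix (Fin n) (Fin n) ℝ) (T : ℕ)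
    (Q : (Fin (T + 1) → V) → (Fin T → Fin N) → Matrix (Fin n) (Fin n) ℝ) : Prop :=
  (∀ (v : Fin (T + 1) → V) (σ : Fin T → Fin N), IsPath E v σ → (Q v σ).PosDef) ∧
    ∀ (v : Fin (T + 2) → V) (σ : Fin (T + 1) → Fin N), IsPath E v σ →
      (Q (fun i : Fin (T + 1) => v i.castSucc) (fun i : Fin T => σ i.castSucc) -
        (A (σ (Fin.last T)))ᵀ *
          Q (fun i : Fin (T + 1) => v i.succ) (fun i : Fin T => σ i.succ) *
            A (σ (Fin.last T))).PosDef

/-- The joint spectral radius of a finite set of matrices (arbitrary switching). -/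
noncomputable def jsr {n N : ℕ} (A : Fin N → Matrix (Fin n) (Fin n) ℝ) : ℝ :=
  Filter.atTop.limsup fun t : ℕ =>
    sSup { x : ℝ | ∃ σ : Fin t → Fin N,
      x = euclOpNorm (pathProd A t σ) ^ (1 / (t : ℝ)) }

/-- The joint spectral radius of the set `M^T` of all products of `T` matrices from `M`:
products of `k` matrices from `M^T` are exactly products of `k * T` matrices from `M`. -/
noncomputable def jsrPow {n N : ℕ} (A : Fin N → Matrix (Fin n) (Fin n) ℝ) (T : ℕ) : ℝ :=
  Filter.atTop.limsup fun k : ℕ =>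
    sSup { x : ℝ | ∃ σ : Fin (k * T) → Fin N,
      x = euclOpNorm (pathProd A (k * T) σ) ^ (1 / (k : ℝ)) }

/-- The optimal value `γ*(G, M)` of the semidefinite program of Corollary 4.6. -/
noncomputable def gammaStar {V : Type*} {n N : ℕ} (E : Set (V × V × Fin N))
    (A : Fin N → Matrix (Fin n) (Fin n) ℝ) : ℝ :=
  sInf {γ : ℝ | 0 < γ ∧ ∃ Q : V → Matrix (Fin n) (Fin n) ℝ,
    (∀ u : V, (Q u).PosDef) ∧ ∀ vi vj : V, ∀ σ : Fin N, (vi, vj, σ) ∈ E →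
      (γ ^ 2 • Q vi - (A σ)ᵀ * Q vj * A σ).PosDef}

/-- The optimal value `γ*(G_T, M^T)` of the semidefinite program applied to the lifted
system `S(G_T, M^T)`. -/
noncomputable def gammaStarLift {V : Type*} {n N : ℕ} (E : Set (V × V × Fin N))
    (A : Fin N → Matrix (Fin n) (Fin n) ℝ) (T : ℕ) : ℝ :=
  sInf {γ : ℝ | 0 < γ ∧ ∃ Q : V → Matrix (Fin n) (Fin n) ℝ,
    (∀ u : V, (Q u).PosDef) ∧
      ∀ (v : Fin (T + 1) → V) (σ : Fin T → Fin N), IsPath E v σ →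
        (γ ^ 2 • Q (v 0) -
          (pathProd A T σ)ᵀ * Q (v (Fin.last T)) * pathProd A T σ).PosDef}

theorem euclOpNorm_nonneg' {n : ℕ} (A : Matrix (Fin n) (Fin n) ℝ) : 0 ≤ euclOpNorm A :=
  norm_nonneg _

theorem mulVec_le_euclOpNorm {n : ℕ} (A : Matrix (Fin n) (Fin n) ℝ) (x : Fin n → ℝ) :
    ‖WithLp.toLp 2 (A.mulVec x)‖ ≤ euclOpNorm A * ‖WithLp.toLp 2 x‖ :=
  (LinearMap.toContinuousLinearMap (Matrix.toEuclideanLin A)).le_opNorm (WithLp.toLp 2 x)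

theorem euclOpNorm_mul_le {n : ℕ} (A B : Matrix (Fin n) (Fin n) ℝ) :
    euclOpNorm (A * B) ≤ euclOpNorm A * euclOpNorm B := by
  refine ContinuousLinearMap.opNorm_le_bound _
    (mul_nonneg (euclOpNorm_nonneg' A) (euclOpNorm_nonneg' B)) fun x => ?_
  have h1 := mulVec_le_euclOpNorm A (B.mulVec (WithLp.ofLp x))
  have h2 := mulVec_le_euclOpNorm B (WithLp.ofLp x)
  rw [Matrix.mulVec_mulVec] at h1
  refine h1.trans ?_
  rw [mul_assoc]
  exact mul_le_mul_of_nonneg_left h2 (euclOpNorm_nonneg' A)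

theorem euclOpNorm_one_le {n : ℕ} : euclOpNorm (1 : Matrix (Fin n) (Fin n) ℝ) ≤ 1 := by
  refine ContinuousLinearMap.opNorm_le_bound _ zero_le_one fun x => ?_
  simp

theorem pathProd_zero {n N : ℕ} (A : Fin N → Matrix (Fin n) (Fin n) ℝ) (σ : Fin 0 → Fin N) :
    pathProd A 0 σ = 1 := by
  simp [pathProd]

theorem pathProd_succ {n N : ℕ} (A : Fin N → Matrix (Fin n) (Fin n) ℝ) (t : ℕ)
    (σ : Fin (t + 1) → Fin N) :
    pathProd A (t + 1) σ = pathProd A t (fun i => σ i.succ) * A (σ 0) := by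
  simp [pathProd, List.ofFn_succ]

theorem euclOpNorm_pathProd_le {n N : ℕ} (A : Fin N → Matrix (Fin n) (Fin n) ℝ) (C : ℝ)
    (hC0 : 0 ≤ C) (hC : ∀ i, euclOpNorm (A i) ≤ C) (t : ℕ) (σ : Fin t → Fin N) :
    euclOpNorm (pathProd A t σ) ≤ C ^ t := by
  induction t with
  | zero => rw [pathProd_zero]; simpa using euclOpNorm_one_le
  | succ t ih =>
    rw [pathProd_succ, pow_succ]
    exact (euclOpNorm_mul_le _ _).trans
      (mul_le_mul (ih _) (hC _) (euclOpNorm_nonneg' _) (pow_nonneg hC0 t))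

theorem exists_label_bound {n N : ℕ} (A : Fin N → Matrix (Fin n) (Fin n) ℝ) :
    ∃ C : ℝ, 1 ≤ C ∧ ∀ i, euclOpNorm (A i) ≤ C := by
  refine ⟨1 + ∑ i, euclOpNorm (A i), ?_, fun i => ?_⟩
  · have := Finset.sum_nonneg (s := Finset.univ) fun i _ => euclOpNorm_nonneg' (A i)
    linarith
  · have := Finset.single_le_sum (f := fun i => euclOpNorm (A i))
      (fun i _ => euclOpNorm_nonneg' (A i)) (Finset.mem_univ i)
    linarith

theorem rpow_root_le {n N : ℕ} (A : Fin N → Matrix (Fin n) (Fin n) ℝ) (C : ℝ)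
    (hC1 : 1 ≤ C) (hC : ∀ i, euclOpNorm (A i) ≤ C) (t : ℕ) (σ : Fin t → Fin N) :
    euclOpNorm (pathProd A t σ) ^ (1 / (t : ℝ)) ≤ C := by
  rcases Nat.eq_zero_or_pos t with rfl | ht
  · simpa using hC1
  · have h0 : 0 ≤ C := zero_le_one.trans hC1
    calc _ ≤ (C ^ t) ^ (1 / (t : ℝ)) :=
          Real.rpow_le_rpow (euclOpNorm_nonneg' _) (euclOpNorm_pathProd_le A C h0 hC t σ)
            (by positivity)
      _ = C := by rw [one_div]; exact Real.pow_rpow_inv_natCast h0 ht.ne'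

theorem cjsr_facts {V : Type} {n N : ℕ} (E : Set (V × V × Fin N))
    (A : Fin N → Matrix (Fin n) (Fin n) ℝ) :
    0 ≤ cjsr E A ∧ ∀ γ, cjsr E A < γ → ∃ T : ℕ, ∀ t, T ≤ t →
      ∀ (v : Fin (t + 1) → V) (σ : Fin t → Fin N), IsPath E v σ →
        euclOpNorm (pathProd A t σ) ≤ γ ^ t := by
  obtain ⟨C, hC1, hC⟩ := exists_label_bound A
  set u : ℕ → ℝ := fun t : ℕ =>
    sSup { x : ℝ | ∃ (v : Fin (t + 1) → V) (σ : Fin t → Fin N),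
      IsPath E v σ ∧ x = euclOpNorm (pathProd A t σ) ^ (1 / (t : ℝ)) } with hu
  have hdef : cjsr E A = atTop.limsup u := rfl
  have hbdd : ∀ t : ℕ, C ∈ upperBounds { x : ℝ | ∃ (v : Fin (t + 1) → V) (σ : Fin t → Fin N),
      IsPath E v σ ∧ x = euclOpNorm (pathProd A t σ) ^ (1 / (t : ℝ)) } := by
    rintro t _ ⟨v, σ, -, rfl⟩
    exact rpow_root_le A C hC1 hC t σ
  have hu0 : ∀ t, 0 ≤ u t := by
    intro t
    apply Real.sSup_nonneg
    rintro _ ⟨v, σ, -, rfl⟩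
    exact Real.rpow_nonneg (euclOpNorm_nonneg' _) _
  have huC : ∀ t, u t ≤ C := fun t => Real.sSup_le (hbdd t) (zero_le_one.trans hC1)
  have hub : IsBoundedUnder (· ≤ ·) atTop u := isBoundedUnder_of ⟨C, huC⟩
  have h0 : 0 ≤ cjsr E A := by
    rw [hdef]
    exact le_limsup_of_frequently_le (Frequently.of_forall hu0) hub
  refine ⟨h0, fun γ hγ => ?_⟩
  have hev := eventually_lt_of_limsup_lt (hdef ▸ hγ) hub
  obtain ⟨T, hT⟩ := eventually_atTop.1 hev
  refine ⟨T + 1, fun t ht v σ hp => ?_⟩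
  have h1 : euclOpNorm (pathProd A t σ) ^ (1 / (t : ℝ)) ≤ u t :=
    le_csSup ⟨C, hbdd t⟩ ⟨v, σ, hp, rfl⟩
  have h2 := (h1.trans_lt (hT t (by omega))).le
  have h3 := pow_le_pow_left₀ (Real.rpow_nonneg (euclOpNorm_nonneg' _) _) h2 t
  rwa [one_div, Real.rpow_inv_natCast_pow (euclOpNorm_nonneg' _) (by omega)] at h3

/-- The paths of arbitrary length starting at `u`. -/
def PathFrom {V : Type} {N : ℕ} (E : Set (V × V × Fin N)) (u : V) : Type :=
  {p : Σ t : ℕ, (Fin (t + 1) → V) × (Fin t → Fin N) // IsPath E p.2.1 p.2.2 ∧ p.2.1 0 = u}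

/-- The weighted value at `x` of the product along a path. -/
noncomputable def pathVal {V : Type} {n N : ℕ} {E : Set (V × V × Fin N)}
    (A : Fin N → Matrix (Fin n) (Fin n) ℝ) (γ : ℝ) {u : V} (p : PathFrom E u)
    (x : Fin n → ℝ) : ℝ :=
  γ⁻¹ ^ p.1.1 * ‖WithLp.toLp 2 ((pathProd A p.1.1 p.1.2.2).mulVec x)‖

/-- The trivial path. -/
def PathFrom.nil {V : Type} {N : ℕ} (E : Set (V × V × Fin N)) (u : V) : PathFrom E u :=
  ⟨⟨0, fun _ => u, Fin.elim0⟩, fun i => i.elim0, rfl⟩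

/-- Prepending an edge. -/
def PathFrom.cons {V : Type} {N : ℕ} {E : Set (V × V × Fin N)} {u w : V} {σ : Fin N}
    (h : (u, w, σ) ∈ E) (p : PathFrom E w) : PathFrom E u :=
  ⟨⟨p.1.1 + 1, Fin.cons u p.1.2.1, Fin.cons σ p.1.2.2⟩, by
    refine ⟨fun i => ?_, rfl⟩
    refine Fin.cases ?_ (fun j => ?_) i
    · have := p.2.2
      simpa [this] using h
    · have := p.2.1 j
      simpa [← Fin.succ_castSucc] using this⟩

theorem pathVal_nil {V : Type} {n N : ℕ} (E : Set (V × V × Fin N))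
    (A : Fin N → Matrix (Fin n) (Fin n) ℝ) (γ : ℝ) (u : V) (x : Fin n → ℝ) :
    pathVal A γ (PathFrom.nil E u) x = ‖WithLp.toLp 2 x‖ := by
  simp [pathVal, PathFrom.nil, pathProd_zero]

theorem pathVal_cons {V : Type} {n N : ℕ} {E : Set (V × V × Fin N)}
    (A : Fin N → Matrix (Fin n) (Fin n) ℝ) (γ : ℝ) {u w : V} {σ : Fin N}
    (h : (u, w, σ) ∈ E) (p : PathFrom E w) (x : Fin n → ℝ) :
    pathVal A γ (PathFrom.cons h p) x = γ⁻¹ * pathVal A γ p ((A σ).mulVec x) := by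
  simp [pathVal, PathFrom.cons, pathProd_succ, pow_succ]
  ring

/-- for every `ε > 0` there exists a `(ρ̂(G,M) + ε)`-multinorm. -/
theorem exists_multinorm {n N : ℕ} (hn : 1 ≤ n) (hN : 1 ≤ N)
    {V : Type} [Fintype V] [Nonempty V]
    (E : Set (V × V × Fin N)) (A : Fin N → Matrix (Fin n) (Fin n) ℝ)
    (hconn : StronglyConnected E) :
    ∀ ε : ℝ, 0 < ε → ∃ ν : V → (Fin n → ℝ) → ℝ,
      IsMultinorm E A (cjsr E A + ε) ν := by
  intro ε hε
  obtain ⟨h0, hT⟩ := cjsr_facts E A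
  obtain ⟨T, hT⟩ := hT (cjsr E A + ε) (by linarith)
  set γ := cjsr E A + ε with hγdef
  have hγ : 0 < γ := by linarith
  obtain ⟨C, hC1, hC⟩ := exists_label_bound A
  have hC0 : 0 ≤ C := zero_le_one.trans hC1
  set K : ℝ := max 1 (γ⁻¹ * C) ^ T with hK
  have hK1 : 1 ≤ K := one_le_pow₀ (le_max_left _ _)
  have hbound : ∀ (u : V) (p : PathFrom E u) (x : Fin n → ℝ),
      pathVal A γ p x ≤ K * ‖WithLp.toLp 2 x‖ := by
    intro u p x
    have h1 := mulVec_le_euclOpNorm (pathProd A p.1.1 p.1.2.2) x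
    have h2 : γ⁻¹ ^ p.1.1 * euclOpNorm (pathProd A p.1.1 p.1.2.2) ≤ K := by
      rcases le_total T p.1.1 with h | h
      · refine le_trans ?_ hK1
        have := mul_le_mul_of_nonneg_left (hT _ h _ _ p.2.1)
          (pow_nonneg (inv_nonneg.2 hγ.le) p.1.1)
        rwa [← mul_pow, inv_mul_cancel₀ hγ.ne', one_pow] at this
      · have := mul_le_mul_of_nonneg_left
          (euclOpNorm_pathProd_le A C hC0 hC p.1.1 p.1.2.2)
          (pow_nonneg (inv_nonneg.2 hγ.le) p.1.1)
        rw [← mul_pow] at this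
        refine this.trans ((pow_le_pow_left₀ (by positivity) (le_max_right 1 _) _).trans ?_)
        exact pow_le_pow_right₀ (le_max_left _ _) h
    calc pathVal A γ p x
        ≤ γ⁻¹ ^ p.1.1 * (euclOpNorm (pathProd A p.1.1 p.1.2.2) * ‖WithLp.toLp 2 x‖) :=
          mul_le_mul_of_nonneg_left h1 (pow_nonneg (inv_nonneg.2 hγ.le) _)
      _ ≤ K * ‖WithLp.toLp 2 x‖ := by
          rw [← mul_assoc]
          exact mul_le_mul_of_nonneg_right h2 (norm_nonneg _)
  have hbdd : ∀ (u : V) (x : Fin n → ℝ),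
      BddAbove (Set.range fun p : PathFrom E u => pathVal A γ p x) := by
    rintro u x
    refine ⟨K * ‖WithLp.toLp 2 x‖, ?_⟩
    rintro _ ⟨p, rfl⟩
    exact hbound u p x
  refine ⟨fun u x => ⨆ p : PathFrom E u, pathVal A γ p x, fun u => ⟨?_, ?_, ?_⟩, ?_⟩
  · intro x y
    haveI : Nonempty (PathFrom E u) := ⟨PathFrom.nil E u⟩
    refine ciSup_le fun p => ?_
    refine le_trans ?_ (add_le_add (le_ciSup (hbdd u x) p) (le_ciSup (hbdd u y) p))
    simp only [pathVal]
    rw [← mul_add, Matrix.mulVec_add, WithLp.toLp_add]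
    exact mul_le_mul_of_nonneg_left (norm_add_le _ _) (pow_nonneg (inv_nonneg.2 hγ.le) _)
  · intro a x
    simp only
    rw [Real.mul_iSup_of_nonneg (abs_nonneg a)]
    congr 1
    ext p
    simp only [pathVal]
    rw [Matrix.mulVec_smul, WithLp.toLp_smul, norm_smul, Real.norm_eq_abs]
    ring
  · intro x hx
    have h := le_ciSup (hbdd u x) (PathFrom.nil E u)
    simp only at h hx
    rw [hx, pathVal_nil] at h
    have := norm_le_zero_iff.1 h
    simpa using this
  · intro u w σ hE x
    haveI : Nonempty (PathFrom E w) := ⟨PathFrom.nil E w⟩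
    refine ciSup_le fun p => ?_
    have h := le_ciSup (hbdd u x) (PathFrom.cons hE p)
    rw [pathVal_cons, inv_mul_le_iff₀ hγ] at h
    exact h
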